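/- Let E₁, E₂ : M_d → M_d be unital quantum channels, let 0 < λ < 1, and set E = λE₁ + (1−λ)E₂. Then for every k ≥ 1, the multiplicative domain of E^k is M_{E^k} = M_{E₁^k} ∩ M_{E₂^k} ∩ {x ∈ M_d : E₁^n(x) = E₂^n(x) for all 1 ≤ n ≤ k}. -/

import Mathlib

open scoped Kronecker ComplexOrder

noncomputable section

/-- The amplification `1_n ⊗ E` of a linear map on matrices, acting on `M_n ⊗ M_ι`. -/
def ampl {ι : Type*} [Fintype ι] (n : ℕ)
    (E : Module.End ℂ (Matrix ι ι ℂ))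
    (A : Matrix (Fin n × ι) (Fin n × ι) ℂ) :
    Matrix (Fin n × ι) (Fin n × ι) ℂ :=
  Matrix.of fun p q => E (Matrix.of fun a b => A (p.1, a) (q.1, b)) p.2 q.2

/-- A quantum channel: completely positive (every amplification preserves positive
semidefiniteness) and trace preserving. -/
def IsQuantumChannel {ι : Type*} [Fintype ι] (E : Module.End ℂ (Matrix ι ι ℂ)) : Prop :=
  (∀ (n : ℕ) (A : Matrix (Fin n × ι) (Fin n × ι) ℂ),
      A.PosSemidef → (ampl n E A).PosSemidef) ∧
    ∀ x : Matrix ι ι ℂ, (E x).trace = x.trace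

/-- The multiplicative domain of a linear map on a matrix algebra. -/
def multDomain {ι : Type*} [Fintype ι] (E : Module.End ℂ (Matrix ι ι ℂ)) :
    Set (Matrix ι ι ℂ) :=
  {x | ∀ y, E (x * y) = E x * E y ∧ E (y * x) = E y * E x}

/-- The multiplicative index: the least `n ≥ 1` from which the chain of multiplicative
domains of the powers of `E` has stabilized. -/
def multIndex {ι : Type*} [Fintype ι] (E : Module.End ℂ (Matrix ι ι ℂ)) : ℕ :=
  sInf {n | 0 < n ∧ ∀ m, n ≤ m → multDomain (E ^ m) = multDomain (E ^ n)}

/-- The stabilized multiplicative domain `M_{E^∞}`. -/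
def stabMultDomain {ι : Type*} [Fintype ι] (E : Module.End ℂ (Matrix ι ι ℂ)) :
    Set (Matrix ι ι ℂ) :=
  ⋂ (n : ℕ) (_ : 0 < n), multDomain (E ^ n)

section Channels

open scoped MatrixOrder in
theorem mul_eq_zero_of_conjTranspose_mul_mul_eq_zero {κ μ : Type*} [Fintype κ] [Fintype μ]
    {M : Matrix κ κ ℂ} (hM : M.PosSemidef) {N : Matrix κ μ ℂ}
    (h : N.conjTranspose * M * N = 0) : M * N = 0 := by
  classical
  obtain ⟨C, rfl⟩ := CStarAlgebra.nonneg_iff_eq_star_mul_self.mp hM.nonneg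
  have hCN : C * N = 0 := by
    rw [← Matrix.conjTranspose_mul_self_eq_zero, Matrix.conjTranspose_mul, ← h,
      Matrix.star_eq_conjTranspose]
    simp only [Matrix.mul_assoc]
  rw [Matrix.mul_assoc, hCN, Matrix.mul_zero]

variable {ι : Type*}

theorem End.pow_apply_one [DecidableEq ι] {E : Module.End ℂ (Matrix ι ι ℂ)} (hu : E 1 = 1)
    (n : ℕ) : (E ^ n) 1 = 1 := by
  rw [Module.End.pow_apply]
  exact Function.iterate_fixed hu n

variable [Fintype ι]

/-- The block matrix `(E (bᵢᴴ bⱼ))ᵢⱼ` is positive semidefinite for a completely positive `E`. -/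
theorem IsQuantumChannel.posSemidef_gram {E : Module.End ℂ (Matrix ι ι ℂ)}
    (h : IsQuantumChannel E) {n : ℕ} (b : Fin n → Matrix ι ι ℂ) :
    (Matrix.of fun p q : Fin n × ι => E ((b p.1).conjTranspose * b q.1) p.2 q.2).PosSemidef := by
  let B : Matrix ι (Fin n × ι) ℂ := Matrix.of fun c q => b q.1 c q.2
  have hB := h.1 n _ (Matrix.posSemidef_conjTranspose_mul_self B)
  exact hB

theorem isQuantumChannel_one : IsQuantumChannel (1 : Module.End ℂ (Matrix ι ι ℂ)) :=
  ⟨fun _ _ hA => hA, fun _ => rfl⟩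

theorem IsQuantumChannel.mul {E F : Module.End ℂ (Matrix ι ι ℂ)}
    (hE : IsQuantumChannel E) (hF : IsQuantumChannel F) : IsQuantumChannel (E * F) :=
  ⟨fun n A hA => hE.1 n _ (hF.1 n A hA), fun x => (hE.2 _).trans (hF.2 x)⟩

theorem IsQuantumChannel.pow {E : Module.End ℂ (Matrix ι ι ℂ)}
    (hE : IsQuantumChannel E) (n : ℕ) : IsQuantumChannel (E ^ n) := by
  induction n with
  | zero => exact isQuantumChannel_one
  | succ n ih => rw [pow_succ]; exact ih.mul hE

theorem IsQuantumChannel.convexComb {E F : Module.End ℂ (Matrix ι ι ℂ)}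
    (hE : IsQuantumChannel E) (hF : IsQuantumChannel F) {t : ℝ} (h0 : 0 ≤ t) (h1 : t ≤ 1) :
    IsQuantumChannel ((t : ℂ) • E + ((1 - t : ℝ) : ℂ) • F) := by
  refine ⟨fun n A hA => ?_, fun x => ?_⟩
  · have h0' : (0 : ℂ) ≤ (t : ℂ) := by exact_mod_cast h0
    have h1' : (0 : ℂ) ≤ ((1 - t : ℝ) : ℂ) := by exact_mod_cast sub_nonneg.2 h1
    exact ((hE.1 n A hA).smul h0').add ((hF.1 n A hA).smul h1')
  · simp only [LinearMap.add_apply, LinearMap.smul_apply, Matrix.trace_add, Matrix.trace_smul,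
      hE.2, hF.2, smul_eq_mul]
    push_cast
    ring

section Blocks

variable {n : ℕ} (m : Fin n → Fin n → Matrix ι ι ℂ) (v w : Fin n → Matrix ι ι ℂ)

theorem block_mul_column_apply (i : Fin n) (a j : ι) :
    ((Matrix.of fun p q : Fin n × ι => m p.1 q.1 p.2 q.2) *
      (Matrix.of fun (p : Fin n × ι) (j : ι) => v p.1 p.2 j)) (i, a) j =
      (∑ l, m i l * v l) a j := by
  simp [Matrix.mul_apply, Fintype.sum_prod_type, Matrix.sum_apply]

theorem column_conjTranspose_mul_column :
    (Matrix.of fun (p : Fin n × ι) (j : ι) => v p.1 p.2 j).conjTranspose *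
      (Matrix.of fun (p : Fin n × ι) (j : ι) => w p.1 p.2 j) =
      ∑ l, (v l).conjTranspose * w l := by
  ext a j
  simp [Matrix.mul_apply, Fintype.sum_prod_type, Matrix.sum_apply]

end Blocks

/-- The square of the Hilbert–Schmidt norm. -/
def hsNormSq (x : Matrix ι ι ℂ) : ℝ := (x.conjTranspose * x).trace.re

theorem hsNormSq_nonneg (x : Matrix ι ι ℂ) : 0 ≤ hsNormSq x :=
  (Complex.nonneg_iff.1 (Matrix.posSemidef_conjTranspose_mul_self x).trace_nonneg).1

theorem ofReal_hsNormSq (x : Matrix ι ι ℂ) : (hsNormSq x : ℂ) = (x.conjTranspose * x).trace :=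
  (Complex.eq_re_of_ofReal_le
    (Matrix.posSemidef_conjTranspose_mul_self x).trace_nonneg).symm

theorem hsNormSq_eq_zero_iff {x : Matrix ι ι ℂ} : hsNormSq x = 0 ↔ x = 0 := by
  rw [← Complex.ofReal_eq_zero, ofReal_hsNormSq]
  exact Matrix.trace_conjTranspose_mul_self_eq_zero_iff

theorem hsNormSq_conjTranspose (x : Matrix ι ι ℂ) : hsNormSq x.conjTranspose = hsNormSq x := by
  simp only [hsNormSq, Matrix.conjTranspose_conjTranspose, Matrix.trace_mul_comm x]

theorem hsNormSq_convexComb (t : ℝ) (a b : Matrix ι ι ℂ) :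
    hsNormSq ((t : ℂ) • a + ((1 - t : ℝ) : ℂ) • b) =
      t * hsNormSq a + (1 - t) * hsNormSq b - t * (1 - t) * hsNormSq (a - b) := by
  simp only [hsNormSq, Matrix.conjTranspose_add, Matrix.conjTranspose_sub,
    Matrix.conjTranspose_smul, Matrix.add_mul, Matrix.mul_add, Matrix.sub_mul, Matrix.mul_sub,
    Matrix.smul_mul, Matrix.mul_smul, Matrix.trace_add, Matrix.trace_sub, Matrix.trace_smul,
    smul_eq_mul, Complex.star_def, Complex.conj_ofReal, Complex.add_re, Complex.sub_re,
    Complex.re_ofReal_mul]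
  ring

variable [DecidableEq ι] {E : Module.End ℂ (Matrix ι ι ℂ)}

theorem IsQuantumChannel.map_conjTranspose (h : IsQuantumChannel E) (x : Matrix ι ι ℂ) :
    E x.conjTranspose = (E x).conjTranspose := by
  have hH := (h.posSemidef_gram ![1, x]).isHermitian
  ext a c
  have := hH.apply (1, a) (0, c)
  simpa using this.symm

/-- The Kadison–Schwarz inequality, together with its case of equality. -/
theorem IsQuantumChannel.schwarz (h : IsQuantumChannel E) (hu : E 1 = 1) (x : Matrix ι ι ℂ) :
    (E (x.conjTranspose * x) - (E x).conjTranspose * E x).PosSemidef ∧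
      (E (x.conjTranspose * x) = (E x).conjTranspose * E x →
        ∀ y, E (y * x) = E y * E x) := by
  have key : ∀ y : Matrix ι ι ℂ,
      (E (x.conjTranspose * x) - (E x).conjTranspose * E x).PosSemidef ∧
      (E (x.conjTranspose * x) = (E x).conjTranspose * E x →
        E (y.conjTranspose * x) = E y.conjTranspose * E x) := by
    intro y
    set b : Fin 3 → Matrix ι ι ℂ := ![1, x, y] with hb
    set v : Fin 3 → Matrix ι ι ℂ := ![-E x, 1, 0] with hv
    set M : Matrix (Fin 3 × ι) (Fin 3 × ι) ℂ :=
      Matrix.of fun p q => E ((b p.1).conjTranspose * b q.1) p.2 q.2 with hM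
    set N : Matrix (Fin 3 × ι) ι ℂ := Matrix.of fun p j => v p.1 p.2 j with hN
    have hpos : M.PosSemidef := h.posSemidef_gram b
    have hMN : M * N = Matrix.of fun (p : Fin 3 × ι) (j : ι) =>
        (∑ l, E ((b p.1).conjTranspose * b l) * v l) p.2 j := by
      ext ⟨i, a⟩ j
      exact block_mul_column_apply (fun i l => E ((b i).conjTranspose * b l)) v i a j
    have hquad : N.conjTranspose * M * N =
        E (x.conjTranspose * x) - (E x).conjTranspose * E x := by
      rw [Matrix.mul_assoc, hMN]
      refine (column_conjTranspose_mul_column v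
        fun i => ∑ l, E ((b i).conjTranspose * b l) * v l).trans ?_
      simp [Fin.sum_univ_three, hb, hv, hu, h.map_conjTranspose, sub_eq_neg_add]
    refine ⟨hquad ▸ hpos.conjTranspose_mul_mul_same N, fun heq => ?_⟩
    rw [heq, sub_self] at hquad
    have hzero : M * N = 0 := mul_eq_zero_of_conjTranspose_mul_mul_eq_zero hpos hquad
    ext a j
    have := congrFun (congrFun (hMN.symm.trans hzero) (2, a)) j
    simp [Fin.sum_univ_three, hb, hv] at this
    exact (neg_add_eq_zero.1 this).symm
  refine ⟨(key 1).1, fun heq y => ?_⟩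
  simpa using (key y.conjTranspose).2 heq

theorem IsQuantumChannel.hsNormSq_le (h : IsQuantumChannel E) (hu : E 1 = 1)
    (x : Matrix ι ι ℂ) : hsNormSq (E x) ≤ hsNormSq x := by
  have := (Complex.nonneg_iff.1 (h.schwarz hu x).1.trace_nonneg).1
  rw [Matrix.trace_sub, h.2, Complex.sub_re] at this
  exact sub_nonneg.1 this

theorem IsQuantumChannel.map_mul_of_hsNormSq_eq (h : IsQuantumChannel E) (hu : E 1 = 1)
    {x : Matrix ι ι ℂ} (hx : hsNormSq (E x) = hsNormSq x) (y : Matrix ι ι ℂ) :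
    E (y * x) = E y * E x := by
  refine (h.schwarz hu x).2 (sub_eq_zero.1 ((h.schwarz hu x).1.trace_eq_zero_iff.1 ?_)) y
  rw [Matrix.trace_sub, h.2, ← ofReal_hsNormSq, ← ofReal_hsNormSq, hx, sub_self]

/-- The multiplicative domain of a unital channel consists of the matrices on which the channel
preserves the Hilbert–Schmidt norm. -/
theorem IsQuantumChannel.mem_multDomain_iff (h : IsQuantumChannel E) (hu : E 1 = 1)
    {x : Matrix ι ι ℂ} : x ∈ multDomain E ↔ hsNormSq (E x) = hsNormSq x := by
  refine ⟨fun hx => ?_, fun hx y => ⟨?_, h.map_mul_of_hsNormSq_eq hu hx y⟩⟩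
  · rw [hsNormSq, ← h.map_conjTranspose, ← (hx _).2, h.2, hsNormSq]
  · have hx' : hsNormSq (E x.conjTranspose) = hsNormSq x.conjTranspose := by
      rw [h.map_conjTranspose, hsNormSq_conjTranspose, hsNormSq_conjTranspose, hx]
    have := h.map_mul_of_hsNormSq_eq hu hx' y.conjTranspose
    rw [← Matrix.conjTranspose_mul, h.map_conjTranspose, h.map_conjTranspose,
      h.map_conjTranspose, ← Matrix.conjTranspose_mul] at this
    exact Matrix.conjTranspose_injective this

theorem IsQuantumChannel.hsNormSq_pow_le_of_le (h : IsQuantumChannel E) (hu : E 1 = 1)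
    (x : Matrix ι ι ℂ) {m n : ℕ} (hmn : m ≤ n) :
    hsNormSq ((E ^ n) x) ≤ hsNormSq ((E ^ m) x) := by
  rw [← Nat.sub_add_cancel hmn, pow_add, Module.End.mul_apply]
  exact (h.pow _).hsNormSq_le (End.pow_apply_one hu _) _

theorem IsQuantumChannel.eq_of_hsNormSq_convexComb_eq {F : Module.End ℂ (Matrix ι ι ℂ)}
    (hE : IsQuantumChannel E) (huE : E 1 = 1) (hF : IsQuantumChannel F) (huF : F 1 = 1)
    {t : ℝ} (h0 : 0 < t) (h1 : t < 1) {x : Matrix ι ι ℂ}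
    (hx : hsNormSq ((t : ℂ) • E x + ((1 - t : ℝ) : ℂ) • F x) = hsNormSq x) : E x = F x := by
  rw [hsNormSq_convexComb] at hx
  have hpos : 0 < t * (1 - t) := mul_pos h0 (sub_pos.2 h1)
  have hEx := mul_le_mul_of_nonneg_left (hE.hsNormSq_le huE x) h0.le
  have hFx := mul_le_mul_of_nonneg_left (hF.hsNormSq_le huF x) (sub_pos.2 h1).le
  have hle : t * (1 - t) * hsNormSq (E x - F x) ≤ 0 := by linarith
  refine sub_eq_zero.1 (hsNormSq_eq_zero_iff.1 (le_antisymm ?_ (hsNormSq_nonneg _)))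
  exact nonpos_of_mul_nonpos_right hle hpos

end Channels

/-- For unital quantum channels `E₁, E₂` and `0 < λ < 1`, the convex
combination `E = λ E₁ + (1-λ) E₂` satisfies, for every `k ≥ 1`,
`M_{E^k} = M_{E₁^k} ∩ M_{E₂^k} ∩ {x : E₁^n x = E₂^n x for 1 ≤ n ≤ k}`. -/
theorem stmt18 (d : ℕ)
    (E₁ E₂ : Module.End ℂ (Matrix (Fin d) (Fin d) ℂ))
    (h₁ : IsQuantumChannel E₁) (hu₁ : E₁ 1 = 1)
    (h₂ : IsQuantumChannel E₂) (hu₂ : E₂ 1 = 1)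
    (lam : ℝ) (hl0 : 0 < lam) (hl1 : lam < 1)
    (E : Module.End ℂ (Matrix (Fin d) (Fin d) ℂ))
    (hE : E = (lam : ℂ) • E₁ + ((1 - lam : ℝ) : ℂ) • E₂)
    (k : ℕ) (hk : 1 ≤ k) :
    multDomain (E ^ k) =
      multDomain (E₁ ^ k) ∩ multDomain (E₂ ^ k) ∩
        {x | ∀ n : ℕ, 1 ≤ n → n ≤ k → (E₁ ^ n) x = (E₂ ^ n) x} := by
  have hchan : IsQuantumChannel E := hE ▸ h₁.convexComb h₂ hl0.le hl1.le
  have happ (x) : E x = (lam : ℂ) • E₁ x + ((1 - lam : ℝ) : ℂ) • E₂ x := by rw [hE]; rfl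
  have hcomb (z : Matrix (Fin d) (Fin d) ℂ) :
      (lam : ℂ) • z + ((1 - lam : ℝ) : ℂ) • z = z := by
    rw [← add_smul, ← Complex.ofReal_add, add_sub_cancel, Complex.ofReal_one, one_smul]
  have hu : E 1 = 1 := by rw [happ, hu₁, hu₂, hcomb]
  ext x
  rw [Set.mem_inter_iff, Set.mem_inter_iff, Set.mem_ofPred_eq,
    (hchan.pow k).mem_multDomain_iff (End.pow_apply_one hu k),
    (h₁.pow k).mem_multDomain_iff (End.pow_apply_one hu₁ k),
    (h₂.pow k).mem_multDomain_iff (End.pow_apply_one hu₂ k)]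
  constructor
  · intro hx
    have hnorm (n : ℕ) (hn : n ≤ k) : hsNormSq ((E ^ n) x) = hsNormSq x :=
      le_antisymm ((hchan.pow n).hsNormSq_le (End.pow_apply_one hu n) x)
        (hx.ge.trans (hchan.hsNormSq_pow_le_of_le hu x hn))
    have hpow (n : ℕ) (hn : n ≤ k) : (E₁ ^ n) x = (E ^ n) x ∧ (E₂ ^ n) x = (E ^ n) x := by
      induction n with
      | zero => simp
      | succ n ih =>
        obtain ⟨ih₁, ih₂⟩ := ih (n.le_succ.trans hn)
        have hEs : (E ^ (n + 1)) x = E ((E ^ n) x) := by rw [pow_succ', Module.End.mul_apply]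
        have heq : E₁ ((E ^ n) x) = E₂ ((E ^ n) x) := by
          refine h₁.eq_of_hsNormSq_convexComb_eq hu₁ h₂ hu₂ hl0 hl1 ?_
          rw [← happ, ← hEs, hnorm _ hn, hnorm _ (n.le_succ.trans hn)]
        rw [hEs, happ, ← heq, hcomb, pow_succ', pow_succ', Module.End.mul_apply,
          Module.End.mul_apply, ih₁, ih₂]
        exact ⟨rfl, heq.symm⟩
    refine ⟨⟨?_, ?_⟩, fun n _ hn => (hpow n hn).1.trans (hpow n hn).2.symm⟩
    · rw [(hpow k le_rfl).1, hx]
    · rw [(hpow k le_rfl).2, hx]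
  · rintro ⟨⟨hx, -⟩, heq⟩
    have hpow (n : ℕ) (hn : n ≤ k) : (E ^ n) x = (E₁ ^ n) x := by
      induction n with
      | zero => simp
      | succ n ih =>
        have hs := heq (n + 1) n.succ_pos hn
        have hn' : (E₁ ^ n) x = (E₂ ^ n) x := by
          rcases n.eq_zero_or_pos with rfl | hpos
          · simp
          · exact heq n hpos (n.le_succ.trans hn)
        rw [pow_succ', pow_succ', Module.End.mul_apply, Module.End.mul_apply, ← hn'] at hs
        rw [pow_succ', pow_succ', Module.End.mul_apply, Module.End.mul_apply,
          ih (n.le_succ.trans hn), happ, ← hs, hcomb]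
    rw [hpow k le_rfl, hx]
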